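/- On ℂ²⊗ℂ², let |a_4⟩ = (1/√2)(|0⟩ + e^{iπ/4}|1⟩), let T = diag(1, e^{iπ/4}), let P_± = (1/2)(I ± σ^z⊗σ^z), let CX = Λ(σ^x) be the controlled-NOT with the first qubit as control, and let K = diag(1, i). Then for every |ψ⟩ ∈ ℂ²: (i) CX · P₊ (|ψ⟩⊗|a_4⟩) = (1/√2)·(T|ψ⟩) ⊗ |0⟩, and (ii) (K⊗I) · CX · P₋ (|ψ⟩⊗|a_4⟩) = (e^{iπ/4}/√2)·(T|ψ⟩) ⊗ |1⟩. (Hence measuring σ^z⊗σ^z on |ψ⟩⊗|a_4⟩, applying CX, measuring the second qubit and applying K if the outcome is |1⟩, deterministically implements the π/8-rotation T = Λ(e^{iπ/4}) on |ψ⟩.) -/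

import Mathlib

open Matrix Kronecker

noncomputable section

/-- Pauli matrix σ^x. -/
def σx : Matrix (Fin 2) (Fin 2) ℂ := !![0, 1; 1, 0]

/-- Pauli matrix σ^z. -/
def σz : Matrix (Fin 2) (Fin 2) ℂ := !![1, 0; 0, -1]

/-- The π/8-rotation gate `T = Λ(e^{iπ/4}) = diag(1, e^{iπ/4})`. -/
def Tgate : Matrix (Fin 2) (Fin 2) ℂ := !![1, 0; 0, Complex.exp (Complex.I * (Real.pi / 4 : ℝ))]

/-- The phase gate `K = diag(1, i)`. -/
def Kgate : Matrix (Fin 2) (Fin 2) ℂ := !![1, 0; 0, Complex.I]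

/-- The controlled-NOT `Λ(σ^x) = |0⟩⟨0| ⊗ I + |1⟩⟨1| ⊗ σ^x` (first qubit as control). -/
def CX : Matrix (Fin 2 × Fin 2) (Fin 2 × Fin 2) ℂ :=
  (!![1, 0; 0, 0] : Matrix (Fin 2) (Fin 2) ℂ) ⊗ₖ 1 +
    (!![0, 0; 0, 1] : Matrix (Fin 2) (Fin 2) ℂ) ⊗ₖ σx

/-- The magic state `|a_4⟩ = (1/√2)(|0⟩ + e^{iπ/4}|1⟩)`. -/
def a4 : Fin 2 → ℂ :=
  ![((1 / Real.sqrt 2 : ℝ) : ℂ),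
    Complex.exp (Complex.I * (Real.pi / 4 : ℝ)) * ((1 / Real.sqrt 2 : ℝ) : ℂ)]

/-- Tensor product of two one-qubit vectors. -/
def tensVec (u v : Fin 2 → ℂ) : Fin 2 × Fin 2 → ℂ := fun x => u x.1 * v x.2

theorem Complex.exp_I_mul_pi_div_four_mul_self :
    Complex.exp (Complex.I * (Real.pi / 4 : ℝ)) * Complex.exp (Complex.I * (Real.pi / 4 : ℝ)) =
      Complex.I := by
  rw [← Complex.exp_add]
  refine Eq.trans (congrArg Complex.exp ?_) Complex.exp_pi_div_two_mul_I
  push_cast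
  ring

/-- With `P_± = (1/2)(I ± σ^z ⊗ σ^z)`, for every `|ψ⟩ ∈ ℂ²`:
(i) `CX · P₊(|ψ⟩ ⊗ |a_4⟩) = (1/√2)·(T|ψ⟩) ⊗ |0⟩`, and
(ii) `(K ⊗ I) · CX · P₋(|ψ⟩ ⊗ |a_4⟩) = (e^{iπ/4}/√2)·(T|ψ⟩) ⊗ |1⟩`.
Hence measuring `σ^z ⊗ σ^z` on `|ψ⟩ ⊗ |a_4⟩`, applying `CX`, measuring the second qubit
and applying `K` on outcome `|1⟩`, deterministically implements `T = Λ(e^{iπ/4})`. -/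
theorem magic_state_implements_T_gate
    (Pplus Pminus : Matrix (Fin 2 × Fin 2) (Fin 2 × Fin 2) ℂ)
    (hPp : Pplus = ((1 : ℂ) / 2) • (1 + σz ⊗ₖ σz))
    (hPm : Pminus = ((1 : ℂ) / 2) • (1 - σz ⊗ₖ σz))
    (ψ : Fin 2 → ℂ) :
    (CX * Pplus).mulVec (tensVec ψ a4) =
      ((1 / Real.sqrt 2 : ℝ) : ℂ) • tensVec (Tgate.mulVec ψ) ![1, 0] ∧
    ((Kgate ⊗ₖ 1) * CX * Pminus).mulVec (tensVec ψ a4) =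
      (Complex.exp (Complex.I * (Real.pi / 4 : ℝ)) * ((1 / Real.sqrt 2 : ℝ) : ℂ)) •
        tensVec (Tgate.mulVec ψ) ![0, 1] := by
  have h := Complex.exp_I_mul_pi_div_four_mul_self
  subst hPp hPm
  simp only [a4, Tgate]
  generalize Complex.exp (Complex.I * (Real.pi / 4 : ℝ)) = e at h ⊢
  generalize ((1 / Real.sqrt 2 : ℝ) : ℂ) = r
  simp only [← Matrix.mulVec_mulVec]
  constructor <;> ext ⟨i, j⟩ <;> fin_cases i <;> fin_cases j <;>
    simp [Matrix.mulVec, dotProduct, Fintype.sum_prod_type, tensVec, CX, Kgate, σx, σz,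
      Matrix.one_apply] <;>
    grind

end
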